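/- Let n ≥ 0 and let M be a model of DB₀ + Coll(Σ₁). If M has a Σ_{n+2}-elementary end extension N that is taller than M, then M ⊨ Coll(Σ_{n+2}). -/

import Mathlib

/- A deep embedding of the first-order language of set theory L_∈ = {∈, =},
   with named variables indexed by ℕ. -/

namespace FOSet

/-- Formulas of L_∈ with variables indexed by ℕ. -/
inductive Fml : Type
  | mem : ℕ → ℕ → Fml
  | eq  : ℕ → ℕ → Fml
  | not : Fml → Fml
  | and : Fml → Fml → Fml
  | or  : Fml → Fml → Fml
  | imp : Fml → Fml → Fml
  | all : ℕ → Fml → Fml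
  | ex  : ℕ → Fml → Fml

namespace Fml

/-- Free variables of a formula. -/
def fv : Fml → Set ℕ
  | mem i j => {i, j}
  | eq i j  => {i, j}
  | not φ   => φ.fv
  | and φ ψ => φ.fv ∪ ψ.fv
  | or φ ψ  => φ.fv ∪ ψ.fv
  | imp φ ψ => φ.fv ∪ ψ.fv
  | all i φ => φ.fv \ {i}
  | ex i φ  => φ.fv \ {i}

end Fml

/-- Satisfaction, in the substructure of `(N, E)` with domain `S`, of a formula
under a valuation `v` : quantifiers range over `S`. -/
def SatIn {N : Type} (E : N → N → Prop) (S : Set N) : (ℕ → N) → Fml → Prop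
  | v, .mem i j => E (v i) (v j)
  | v, .eq i j  => v i = v j
  | v, .not φ   => ¬ SatIn E S v φ
  | v, .and φ ψ => SatIn E S v φ ∧ SatIn E S v ψ
  | v, .or φ ψ  => SatIn E S v φ ∨ SatIn E S v ψ
  | v, .imp φ ψ => SatIn E S v φ → SatIn E S v ψ
  | v, .all i φ => ∀ a ∈ S, SatIn E S (Function.update v i a) φ
  | v, .ex i φ  => ∃ a ∈ S, SatIn E S (Function.update v i a) φ

/-- Satisfaction in the full structure `(N, E)`. -/
def Sat {N : Type} (E : N → N → Prop) (v : ℕ → N) (φ : Fml) : Prop :=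
  SatIn E Set.univ v φ

/-- Δ₀ (= Σ₀ = Π₀) formulas: every quantifier is bounded, i.e. of the form
`∀ x ∈ y` or `∃ x ∈ y`. -/
inductive IsDelta0 : Fml → Prop
  | mem (i j : ℕ) : IsDelta0 (Fml.mem i j)
  | eq (i j : ℕ)  : IsDelta0 (Fml.eq i j)
  | not {φ} : IsDelta0 φ → IsDelta0 φ.not
  | and {φ ψ} : IsDelta0 φ → IsDelta0 ψ → IsDelta0 (φ.and ψ)
  | or {φ ψ}  : IsDelta0 φ → IsDelta0 ψ → IsDelta0 (φ.or ψ)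
  | imp {φ ψ} : IsDelta0 φ → IsDelta0 ψ → IsDelta0 (φ.imp ψ)
  | ball {i j : ℕ} {φ} : i ≠ j → IsDelta0 φ →
      IsDelta0 (Fml.all i ((Fml.mem i j).imp φ))
  | bex {i j : ℕ} {φ} : i ≠ j → IsDelta0 φ →
      IsDelta0 (Fml.ex i ((Fml.mem i j).and φ))

/-- The Lévy hierarchy: `(levels n).1` is the class of Σ_n formulas and
`(levels n).2` the class of Π_n formulas. -/
def levels : ℕ → (Fml → Prop) × (Fml → Prop)
  | 0 => (IsDelta0, IsDelta0)
  | n + 1 =>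
      (fun φ => ∃ i ψ, (levels n).2 ψ ∧ φ = Fml.ex i ψ,
       fun φ => ∃ i ψ, (levels n).1 ψ ∧ φ = Fml.all i ψ)

def IsSigma (n : ℕ) : Fml → Prop := (levels n).1

def IsPi (n : ℕ) : Fml → Prop := (levels n).2

variable {M N : Type}

/-- `p` is the (Kuratowski) pair `{a, b}` in the sense of `E`. -/
def IsPairOf (E : M → M → Prop) (p a b : M) : Prop :=
  ∀ w, E w p ↔ (w = a ∨ w = b)

/-- `z` is the ordered pair `(a, b)` (Kuratowski) in the sense of `E`. -/
def IsOPairOf (E : M → M → Prop) (z a b : M) : Prop :=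
  ∃ s t, IsPairOf E s a a ∧ IsPairOf E t a b ∧ IsPairOf E z s t

/-- Valuation sending variable 0 to `x` and every other variable to `y`;
used for formulas φ(x, y) with free variables among {0, 1}. -/
def val2 (x y : M) : ℕ → M := fun k => if k = 0 then x else y

/-- Valuation sending 0 ↦ x, 1 ↦ y, everything else ↦ v;
used for formulas φ(x, y, v) with free variables among {0, 1, 2}. -/
def val3 (x y v : M) : ℕ → M := fun k => if k = 0 then x else if k = 1 then y else v

/-- `M ⊨ Sep(φ)` for φ = φ(x, v) (x is variable 0, v is variable 1):
∀v∀p∃q∀x(x∈q ↔ x∈p ∧ φ(x,v)). -/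
def SepAx (E : M → M → Prop) (φ : Fml) : Prop :=
  ∀ v p : M, ∃ q : M, ∀ x : M, E x q ↔ (E x p ∧ Sat E (val2 x v) φ)

/-- `M ⊨ Sep⁻(φ)` for a parameter-free φ = φ(x) (x is variable 0). -/
def SepMinusAx (E : M → M → Prop) (φ : Fml) : Prop :=
  ∀ p : M, ∃ q : M, ∀ x : M, E x q ↔ (E x p ∧ Sat E (fun _ => x) φ)

/-- `(M, E) ⊨ DB₀`: extensionality, empty set, pairing, union, cartesian
product, and Δ₀ separation. -/
def SatDB0 (E : M → M → Prop) : Prop :=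
  (∀ a b : M, (∀ x, E x a ↔ E x b) → a = b) ∧
  (∃ e : M, ∀ x, ¬ E x e) ∧
  (∀ a b : M, ∃ p, IsPairOf E p a b) ∧
  (∀ a : M, ∃ u, ∀ x, E x u ↔ ∃ y, E y a ∧ E x y) ∧
  (∀ a b : M, ∃ c, ∀ z, E z c ↔ ∃ x y, E x a ∧ E y b ∧ IsOPairOf E z x y) ∧
  (∀ φ, IsDelta0 φ → φ.fv ⊆ {0, 1} → SepAx E φ)

/-- `M ⊨ Coll(φ)` for φ = φ(x, y, v) (x = var 0, y = var 1, v = var 2):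
∀v∀p(∀x∈p ∃y φ → ∃q ∀x∈p ∃y∈q φ). -/
def CollAx (E : M → M → Prop) (φ : Fml) : Prop :=
  ∀ v p : M, (∀ x, E x p → ∃ y, Sat E (val3 x y v) φ) →
    ∃ q, ∀ x, E x p → ∃ y, E y q ∧ Sat E (val3 x y v) φ

/-- `M ⊨ Coll_s(φ)`: ∀v∀p∃q∀x∈p(∃y φ ↔ ∃y∈q φ). -/
def CollSAx (E : M → M → Prop) (φ : Fml) : Prop :=
  ∀ v p : M, ∃ q, ∀ x, E x p →
    ((∃ y, Sat E (val3 x y v) φ) ↔ ∃ y, E y q ∧ Sat E (val3 x y v) φ)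

/-- `M ⊨ Coll_w(φ)`: ∀v(∀x∃y φ → ∀p∃q∀x∈p∃y∈q φ). -/
def CollWAx (E : M → M → Prop) (φ : Fml) : Prop :=
  ∀ v : M, (∀ x, ∃ y, Sat E (val3 x y v) φ) →
    ∀ p, ∃ q, ∀ x, E x p → ∃ y, E y q ∧ Sat E (val3 x y v) φ

/-- `M ⊨ Coll⁻(φ)` for a parameter-free φ = φ(x, y) (x = var 0, y = var 1). -/
def CollMinusAx (E : M → M → Prop) (φ : Fml) : Prop :=
  ∀ p : M, (∀ x, E x p → ∃ y, Sat E (val2 x y) φ) →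
    ∃ q, ∀ x, E x p → ∃ y, E y q ∧ Sat E (val2 x y) φ

/-- `M ⊨ Coll_w⁻(φ)` for a parameter-free φ = φ(x, y). -/
def CollWMinusAx (E : M → M → Prop) (φ : Fml) : Prop :=
  (∀ x : M, ∃ y, Sat E (val2 x y) φ) →
    ∀ p, ∃ q, ∀ x, E x p → ∃ y, E y q ∧ Sat E (val2 x y) φ

/-- `M ⊨ Coll_s⁻(φ)` for a parameter-free φ = φ(x, y). -/
def CollSMinusAx (E : M → M → Prop) (φ : Fml) : Prop :=
  ∀ p : M, ∃ q, ∀ x, E x p →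
    ((∃ y, Sat E (val2 x y) φ) ↔ ∃ y, E y q ∧ Sat E (val2 x y) φ)

/- Schemas over a class Γ of formulas. -/

def CollScheme (E : M → M → Prop) (Γ : Fml → Prop) : Prop :=
  ∀ φ, Γ φ → φ.fv ⊆ {0, 1, 2} → CollAx E φ

def CollSScheme (E : M → M → Prop) (Γ : Fml → Prop) : Prop :=
  ∀ φ, Γ φ → φ.fv ⊆ {0, 1, 2} → CollSAx E φ

def CollWScheme (E : M → M → Prop) (Γ : Fml → Prop) : Prop :=
  ∀ φ, Γ φ → φ.fv ⊆ {0, 1, 2} → CollWAx E φ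

def CollMinusScheme (E : M → M → Prop) (Γ : Fml → Prop) : Prop :=
  ∀ φ, Γ φ → φ.fv ⊆ {0, 1} → CollMinusAx E φ

def CollWMinusScheme (E : M → M → Prop) (Γ : Fml → Prop) : Prop :=
  ∀ φ, Γ φ → φ.fv ⊆ {0, 1} → CollWMinusAx E φ

def CollSMinusScheme (E : M → M → Prop) (Γ : Fml → Prop) : Prop :=
  ∀ φ, Γ φ → φ.fv ⊆ {0, 1} → CollSMinusAx E φ

def SepScheme (E : M → M → Prop) (Γ : Fml → Prop) : Prop :=
  ∀ φ, Γ φ → φ.fv ⊆ {0, 1} → SepAx E φ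

def SepMinusScheme (E : M → M → Prop) (Γ : Fml → Prop) : Prop :=
  ∀ φ, Γ φ → φ.fv ⊆ {0} → SepMinusAx E φ

/- Extensions. We present an extension `M ⊆ N` by an embedding `f : M → N`. -/

/-- `f` embeds `(M, EM)` as a substructure of `(N, EN)`. -/
def SubStr (EM : M → M → Prop) (EN : N → N → Prop) (f : M → N) : Prop :=
  Function.Injective f ∧ ∀ a b : M, EM a b ↔ EN (f a) (f b)

/-- `f : M → N` is a (fully) elementary embedding. -/
def ElemEmb (EM : M → M → Prop) (EN : N → N → Prop) (f : M → N) : Prop :=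
  ∀ (φ : Fml) (v : ℕ → M), Sat EM v φ ↔ Sat EN (f ∘ v) φ

/-- `f : M → N` is a Σ_n-elementary embedding (M ≺_{Σ_n} N). -/
def SigmaElemEmb (n : ℕ) (EM : M → M → Prop) (EN : N → N → Prop) (f : M → N) : Prop :=
  ∀ φ, IsSigma n φ → ∀ v : ℕ → M, Sat EM v φ ↔ Sat EN (f ∘ v) φ

/-- `f : M → N` is a Δ₀-elementary embedding (M ≺_{Δ₀} N). -/
def Delta0ElemEmb (EM : M → M → Prop) (EN : N → N → Prop) (f : M → N) : Prop :=
  ∀ φ, IsDelta0 φ → ∀ v : ℕ → M, Sat EM v φ ↔ Sat EN (f ∘ v) φ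

/-- The convex hull M* of (the image of) M in N:
{a ∈ N : N ⊨ a ∈ m for some m ∈ M}. -/
def hull (EN : N → N → Prop) (f : M → N) : Set N := {a | ∃ m : M, EN a (f m)}

/-- The substructure of `N` with domain `S` is a Σ_n-elementary substructure of
`N` (S ≺_{Σ_n} N). -/
def SigmaElemInTop (n : ℕ) (EN : N → N → Prop) (S : Set N) : Prop :=
  ∀ φ, IsSigma n φ → ∀ v : ℕ → N, (∀ k, v k ∈ S) → (SatIn EN S v φ ↔ Sat EN v φ)

/-- The substructure of `N` with domain `S` is a fully elementary substructure. -/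
def ElemInTop (EN : N → N → Prop) (S : Set N) : Prop :=
  ∀ (φ : Fml) (v : ℕ → N), (∀ k, v k ∈ S) → (SatIn EN S v φ ↔ Sat EN v φ)

/-- `f` is a Σ_n-elementary embedding of `M` into the substructure of `N` with
domain `S` (e.g. M ≺_{Σ_n} M*). -/
def SigmaElemEmbInto (n : ℕ) (EM : M → M → Prop) (EN : N → N → Prop) (f : M → N)
    (S : Set N) : Prop :=
  ∀ φ, IsSigma n φ → ∀ v : ℕ → M, Sat EM v φ ↔ SatIn EN S (f ∘ v) φ

/-- `f` is a fully elementary embedding of `M` into the substructure of `N`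
with domain `S`. -/
def ElemEmbInto (EM : M → M → Prop) (EN : N → N → Prop) (f : M → N) (S : Set N) : Prop :=
  ∀ (φ : Fml) (v : ℕ → M), Sat EM v φ ↔ SatIn EN S (f ∘ v) φ

/-- The extension presented by `f` is an end extension. -/
def IsEndEmb (EN : N → N → Prop) (f : M → N) : Prop :=
  ∀ (m : M) (a : N), EN a (f m) → ∃ m', f m' = a

/-- The extension presented by `f` is cofinal. -/
def Cofinal (EN : N → N → Prop) (f : M → N) : Prop :=
  ∀ a : N, ∃ m : M, EN a (f m)

/-- `a` is a transitive set in the sense of `(N, EN)`. -/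
def TransIn (EN : N → N → Prop) (a : N) : Prop :=
  ∀ x, EN x a → ∀ y, EN y x → EN y a

/-- The extension presented by `f` is taller. -/
def Taller (EN : N → N → Prop) (f : M → N) : Prop :=
  ∃ a : N, ∀ m : M, EN (f m) a

/-- The extension presented by `f` is taller*. -/
def TallerStar (EN : N → N → Prop) (f : M → N) : Prop :=
  ∃ a : N, (∀ m : M, EN (f m) a) ∧ TransIn EN a

/-- Property end_n: for every elementary extension N of M, M* ≺_{Σ_n} N. -/
def HasEnd (n : ℕ) (EM : M → M → Prop) : Prop :=
  ∀ (N : Type) (EN : N → N → Prop) (f : M → N), ElemEmb EM EN f →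
    SigmaElemInTop n EN (hull EN f)

/-- Property cof_n: for every elementary extension N of M, M ≺_{Σ_n} M*. -/
def HasCof (n : ℕ) (EM : M → M → Prop) : Prop :=
  ∀ (N : Type) (EN : N → N → Prop) (f : M → N), ElemEmb EM EN f →
    SigmaElemEmbInto n EM EN f (hull EN f)

/-- Property COF_n: for every Δ₀-elementary cofinal extension N of M with
N ⊨ DB₀, M ≺_{Σ_n} N. -/
def HasCOF (n : ℕ) (EM : M → M → Prop) : Prop :=
  ∀ (N : Type) (EN : N → N → Prop) (f : M → N), SatDB0 EN →
    Delta0ElemEmb EM EN f → Cofinal EN f → SigmaElemEmb n EM EN f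

/-- TCo: every set is an element of some transitive set. -/
def SatTCo (E : M → M → Prop) : Prop :=
  ∀ a : M, ∃ t, E a t ∧ TransIn E t

/-- `a` is an ordinal in the sense of `(M, E)`: a transitive set linearly
ordered by `E`. -/
def OrdIn (E : M → M → Prop) (a : M) : Prop :=
  TransIn E a ∧ ∀ x y, E x a → E y a → (E x y ∨ x = y ∨ E y x)

/-- The formula φ(p, α, v) (p = var 0, α = var 1, v = var 2), with parameter
`v ∈ M`, defines a resolution on `(M, E)`. -/
def IsResolution (E : M → M → Prop) (φ : Fml) (v : M) : Prop :=
  φ.fv ⊆ {0, 1, 2} ∧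
  (∀ α, OrdIn E α → ∃! p, Sat E (val3 p α v) φ) ∧
  (∀ α β p q, E α β → Sat E (val3 p α v) φ → Sat E (val3 q β v) φ →
    ∀ x, E x p → E x q) ∧
  (∀ x, ∃ α, OrdIn E α ∧ ∀ p, Sat E (val3 p α v) φ → E x p)

end FOSet

namespace FOSet

/-- Prepend an element to a sequence. -/
def scons {A : Type} (a : A) (u : ℕ → A) : ℕ → A
  | 0 => a
  | j + 1 => u j

notation:67 a:68 "∷" u:67 => scons a u

/-- Predicates of valuations, given uniformly over all structures. -/
abbrev Pred := ∀ A : Type, (A → A → Prop) → (ℕ → A) → Prop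

/-- Uniformly Δ₀ predicates, with de Bruijn style bounded quantification. -/
inductive D0 : Pred → Prop
  | mem (i j : ℕ) : D0 (fun _ E u => E (u i) (u j))
  | eq (i j : ℕ) : D0 (fun _ _ u => u i = u j)
  | not {P : Pred} : D0 P → D0 (fun A E u => ¬ P A E u)
  | and {P Q : Pred} : D0 P → D0 Q → D0 (fun A E u => P A E u ∧ Q A E u)
  | bex {P : Pred} (j : ℕ) : D0 P → D0 (fun A E u => ∃ a, E a (u j) ∧ P A E (a ∷ u))

/-- Uniformly Σ_k predicates. -/
def Sg : ℕ → Pred → Prop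
  | 0, P => D0 P
  | k + 1, P => ∃ Q, Sg k Q ∧ ∀ A E u, P A E u ↔ ∃ a, ¬ Q A E (a ∷ u)

/-- Uniformly Π_k predicates. -/
def Pg (k : ℕ) (P : Pred) : Prop := Sg k (fun A E u => ¬ P A E u)

theorem D0.congr {P Q : Pred} (h : D0 P) (hPQ : ∀ A E u, P A E u ↔ Q A E u) : D0 Q := by
  have : P = Q := by
    funext A E u
    exact propext (hPQ A E u)
  exact this ▸ h

theorem Sg.congr {k : ℕ} {P Q : Pred} (h : Sg k P) (hPQ : ∀ A E u, P A E u ↔ Q A E u) :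
    Sg k Q := by
  have : P = Q := by
    funext A E u
    exact propext (hPQ A E u)
  exact this ▸ h

theorem Pg.congr {k : ℕ} {P Q : Pred} (h : Pg k P) (hPQ : ∀ A E u, P A E u ↔ Q A E u) :
    Pg k Q :=
  Sg.congr h fun A E u => not_congr (hPQ A E u)

theorem Sg.not {k : ℕ} {P : Pred} (h : Sg k P) : Pg k (fun A E u => ¬ P A E u) :=
  Sg.congr h fun _ _ _ => not_not.symm

theorem D0.or {P Q : Pred} (hP : D0 P) (hQ : D0 Q) : D0 (fun A E u => P A E u ∨ Q A E u) :=
  (hP.not.and hQ.not).not.congr fun A E u => by tauto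

theorem D0.imp {P Q : Pred} (hP : D0 P) (hQ : D0 Q) : D0 (fun A E u => P A E u → Q A E u) :=
  (hP.and hQ.not).not.congr fun A E u => by tauto

theorem D0.ball {P : Pred} (j : ℕ) (hP : D0 P) :
    D0 (fun A E u => ∀ a, E a (u j) → P A E (a ∷ u)) :=
  (hP.not.bex j).not.congr fun A E u => by
    push Not
    rfl

theorem scons_comp {A : Type} (a : A) (u : ℕ → A) (σ : ℕ → ℕ) :
    (a ∷ u) ∘ (0 ∷ (Nat.succ ∘ σ)) = a ∷ (u ∘ σ) := by
  funext j
  cases j <;> rfl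

theorem comp_scons {A B : Type} (f : A → B) (a : A) (u : ℕ → A) :
    f ∘ (a ∷ u) = f a ∷ (f ∘ u) := by
  funext j
  cases j <;> rfl

theorem D0.subst {P : Pred} (h : D0 P) : ∀ σ : ℕ → ℕ, D0 (fun A E u => P A E (u ∘ σ)) := by
  induction h with
  | mem i j => exact fun σ => D0.mem (σ i) (σ j)
  | eq i j => exact fun σ => D0.eq (σ i) (σ j)
  | not _ ih => exact fun σ => (ih σ).not
  | and _ _ ih₁ ih₂ => exact fun σ => (ih₁ σ).and (ih₂ σ)
  | bex j _ ih =>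
    intro σ
    refine ((ih (0 ∷ (Nat.succ ∘ σ))).bex (σ j)).congr fun A E u => ?_
    simp only [scons_comp]
    rfl

theorem Sg.subst {k : ℕ} {P : Pred} (h : Sg k P) (σ : ℕ → ℕ) :
    Sg k (fun A E u => P A E (u ∘ σ)) := by
  induction k generalizing P σ with
  | zero => exact D0.subst h σ
  | succ k ih =>
    obtain ⟨Q, hQ, hPQ⟩ := h
    refine ⟨_, ih hQ (0 ∷ (Nat.succ ∘ σ)), fun A E u => ?_⟩
    simp only [scons_comp, hPQ]

theorem Pg.subst {k : ℕ} {P : Pred} (h : Pg k P) (σ : ℕ → ℕ) :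
    Pg k (fun A E u => P A E (u ∘ σ)) :=
  Sg.subst h σ

theorem Pg.ex {k : ℕ} {P : Pred} (h : Pg k P) :
    Sg (k + 1) (fun A E u => ∃ a, P A E (a ∷ u)) :=
  ⟨_, h, fun A E u => by simp only [not_not]⟩

theorem Sg.all {k : ℕ} {P : Pred} (h : Sg k P) :
    Pg (k + 1) (fun A E u => ∀ a, P A E (a ∷ u)) :=
  ⟨_, h, fun A E u => by push Not; rfl⟩

theorem Pg.exists_all {k : ℕ} {P : Pred} (h : Pg (k + 1) P) :
    ∃ Q, Sg k Q ∧ ∀ A E u, P A E u ↔ ∀ a, Q A E (a ∷ u) := by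
  obtain ⟨Q, hQ, hPQ⟩ := h
  refine ⟨Q, hQ, fun A E u => not_iff_not.1 ((hPQ A E u).trans ?_)⟩
  push Not
  rfl

theorem Pg.toSg {k : ℕ} {P : Pred} (h : Pg k P) : Sg (k + 1) P :=
  ⟨_, Sg.subst h Nat.succ, fun A E u => by
    have : ∀ a, (a ∷ u) ∘ Nat.succ = u := fun _ => rfl
    simp only [this, not_not]
    exact ⟨fun h => ⟨u 0, h⟩, fun ⟨_, h⟩ => h⟩⟩

theorem Sg.succ {k : ℕ} {P : Pred} (h : Sg k P) : Sg (k + 1) P := by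
  induction k generalizing P with
  | zero => exact Pg.toSg (k := 0) (D0.not h)
  | succ k ih =>
    obtain ⟨Q, hQ, hPQ⟩ := h
    exact ⟨Q, ih hQ, hPQ⟩

theorem Pg.succ {k : ℕ} {P : Pred} (h : Pg k P) : Pg (k + 1) P :=
  Sg.succ h

theorem Pg.mono {k l : ℕ} (hkl : k ≤ l) {P : Pred} (h : Pg k P) : Pg l P := by
  induction hkl with
  | refl => exact h
  | step _ ih => exact ih.succ

theorem D0.and_Sg_and_or_Sg {k : ℕ} {P Q : Pred} (hP : D0 P) (hQ : Sg k Q) :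
    Sg k (fun A E u => P A E u ∧ Q A E u) ∧ Sg k (fun A E u => P A E u ∨ Q A E u) := by
  induction k generalizing P Q with
  | zero => exact ⟨hP.and hQ, hP.or hQ⟩
  | succ k ih =>
    obtain ⟨R, hR, hQR⟩ := hQ
    have hP' := (hP.subst Nat.succ).not
    constructor
    · refine ⟨_, (ih hP' hR).2, fun A E u => ?_⟩
      have : ∀ a, (a ∷ u) ∘ Nat.succ = u := fun _ => rfl
      simp only [this, hQR, not_or, not_not, exists_and_left]
    · refine ⟨_, (ih hP' hR).1, fun A E u => ?_⟩
      have : ∀ a, (a ∷ u) ∘ Nat.succ = u := fun _ => rfl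
      have : Nonempty A := ⟨u 0⟩
      simp only [*, not_and_or, not_not, exists_or, exists_const]

theorem D0.and_Pg {k : ℕ} {P Q : Pred} (hP : D0 P) (hQ : Pg k Q) :
    Pg k (fun A E u => P A E u ∧ Q A E u) :=
  (hP.not.and_Sg_and_or_Sg hQ).2.congr fun A E u => by tauto

/-! ### Ordered pairs -/

theorem isPairOf_iff {A : Type} {E : A → A → Prop} {p a b : A} :
    IsPairOf E p a b ↔ E a p ∧ E b p ∧ ∀ z, E z p → z = a ∨ z = b := by
  constructor
  · exact fun h => ⟨(h a).2 (Or.inl rfl), (h b).2 (Or.inr rfl), fun z => (h z).1⟩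
  · rintro ⟨ha, hb, h⟩ z
    refine ⟨h z, ?_⟩
    rintro (rfl | rfl) <;> assumption

theorem D0.isPairOf (i j k : ℕ) : D0 (fun _ E u => IsPairOf E (u i) (u j) (u k)) :=
  ((D0.mem j i).and ((D0.mem k i).and
    (((D0.eq 0 (j + 1)).or (D0.eq 0 (k + 1))).ball i))).congr
      fun _ _ _ => isPairOf_iff.symm

theorem D0.isOPairOf (i j k : ℕ) : D0 (fun _ E u => IsOPairOf E (u i) (u j) (u k)) := by
  refine ((((D0.isPairOf 1 (j + 2) (j + 2)).and ((D0.isPairOf 0 (j + 2) (k + 2)).and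
    (D0.isPairOf (i + 2) 1 0))).bex (i + 1)).bex i).congr fun A E u => ?_
  constructor
  · rintro ⟨s, -, t, -, h⟩
    exact ⟨s, t, h⟩
  · rintro ⟨s, t, h₁, h₂, h₃⟩
    exact ⟨s, (h₃ s).2 (Or.inl rfl), t, (h₃ t).2 (Or.inr rfl), h₁, h₂, h₃⟩

theorem IsOPairOf.exists_mem {A : Type} {E : A → A → Prop} {w a b : A}
    (h : IsOPairOf E w a b) : ∃ t, E t w ∧ E a t ∧ E b t := by
  obtain ⟨s, t, _, h₂, h₃⟩ := h
  exact ⟨t, (h₃ t).2 (Or.inr rfl), (h₂ a).2 (Or.inl rfl), (h₂ b).2 (Or.inr rfl)⟩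

theorem IsOPairOf.inj {A : Type} {E : A → A → Prop} {w a b a' b' : A}
    (h : IsOPairOf E w a b) (h' : IsOPairOf E w a' b') : a = a' ∧ b = b' := by
  obtain ⟨s, t, h₁, h₂, h₃⟩ := h
  obtain ⟨s', t', h₁', h₂', h₃'⟩ := h'
  unfold IsPairOf at *
  have e₁ := h₃ s'
  have e₂ := h₃ t'
  have e₃ := h₃' s
  have e₄ := h₃' t
  have haa : a = a' := by
    have := h₁ a
    have := h₁' a
    have := h₁ a'
    have := h₂ a
    have := h₂ a'
    have := h₂' a'
    grind
  subst haa
  refine ⟨rfl, ?_⟩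
  have := h₁ b
  have := h₁' b
  have := h₁ b'
  have := h₁' b'
  have := h₂ b
  have := h₂' b
  have := h₂ b'
  have := h₂' b'
  grind

/-- `P` holds of all components of the ordered pair `u j`. -/
def DecAll (j : ℕ) (P : Pred) : Pred :=
  fun A E u => ∀ a b, IsOPairOf E (u j) a b → P A E (b ∷ a ∷ u)

/-- `u j` is an ordered pair and `P` holds of its components. -/
def DecEx (j : ℕ) (P : Pred) : Pred :=
  fun A E u => ∃ a b, IsOPairOf E (u j) a b ∧ P A E (b ∷ a ∷ u)

theorem not_decAll (j : ℕ) (P : Pred) (A : Type) (E : A → A → Prop) (u : ℕ → A) :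
    ¬ DecAll j P A E u ↔ DecEx j (fun A E u => ¬ P A E u) A E u := by
  unfold DecAll DecEx
  push Not
  rfl

theorem not_decEx (j : ℕ) (P : Pred) (A : Type) (E : A → A → Prop) (u : ℕ → A) :
    ¬ DecEx j P A E u ↔ DecAll j (fun A E u => ¬ P A E u) A E u := by
  unfold DecAll DecEx
  push Not
  rfl

theorem D0.decEx {P : Pred} (hP : D0 P) (j : ℕ) : D0 (DecEx j P) := by
  refine (((((D0.isOPairOf (j + 3) 1 0).and
    (hP.subst (0 ∷ 1 ∷ fun i => i + 3))).bex 1).bex 0).bex j).congr fun A E u => ?_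
  have key : ∀ b a t : A, (b ∷ a ∷ t ∷ u) ∘ (0 ∷ 1 ∷ fun i => i + 3) = b ∷ a ∷ u := by
    intro b a t
    funext i
    rcases i with _ | _ | i <;> rfl
  simp only [key]
  constructor
  · rintro ⟨t, -, a, -, b, -, h⟩
    exact ⟨a, b, h⟩
  · rintro ⟨a, b, h, hp⟩
    obtain ⟨t, ht, ha, hb⟩ := h.exists_mem
    exact ⟨t, ht, a, ha, b, hb, h, hp⟩

theorem Sg.dec {k : ℕ} {P : Pred} (hP : Sg k P) (j : ℕ) :
    Sg k (DecAll j P) ∧ Sg k (DecEx j P) := by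
  induction k generalizing P j with
  | zero =>
    exact ⟨((D0.not hP).decEx j).not.congr fun A E u => by
      rw [not_decEx]
      simp only [not_not], D0.decEx hP j⟩
  | succ k ih =>
    obtain ⟨Q, hQ, hPQ⟩ := hP
    have hQ' := hQ.subst (2 ∷ 0 ∷ 1 ∷ fun i => i + 3)
    have key : ∀ {A : Type} (u : ℕ → A) (b a c : A),
        (b ∷ a ∷ c ∷ u) ∘ (2 ∷ 0 ∷ 1 ∷ fun i => i + 3) = c ∷ b ∷ a ∷ u := by
      intro A u b a c
      funext i
      rcases i with _ | _ | _ | i <;> rfl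
    constructor
    · refine ⟨_, (ih hQ' (j + 1)).2, fun A E u => ?_⟩
      simp only [not_decEx]
      simp only [DecAll, key, hPQ]
      constructor
      · intro h
        by_cases hab : ∃ a b, IsOPairOf E (u j) a b
        · obtain ⟨a, b, hab⟩ := hab
          obtain ⟨c, hc⟩ := h a b hab
          refine ⟨c, fun a' b' hab' => ?_⟩
          obtain ⟨rfl, rfl⟩ := hab.inj hab'
          exact hc
        · push Not at hab
          exact ⟨u 0, fun a b h => absurd h (hab a b)⟩
      · rintro ⟨c, hc⟩ a b hab
        exact ⟨c, hc a b hab⟩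
    · refine ⟨_, (ih hQ' (j + 1)).1, fun A E u => ?_⟩
      simp only [not_decAll]
      simp only [DecEx, key, hPQ]
      constructor
      · rintro ⟨a, b, h, c, hc⟩
        exact ⟨c, a, b, h, hc⟩
      · rintro ⟨c, a, b, h, hc⟩
        exact ⟨a, b, h, c, hc⟩

theorem Sg.decAll {k : ℕ} {P : Pred} (hP : Sg k P) (j : ℕ) : Sg k (DecAll j P) :=
  (hP.dec j).1

theorem Pg.decEx {k : ℕ} {P : Pred} (hP : Pg k P) (j : ℕ) : Pg k (DecEx j P) :=
  (Sg.dec hP j).1.congr fun _ _ _ => (not_decEx _ _ _ _ _).symm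

/-- Every two elements have an ordered pair. -/
def HasPairs {A : Type} (E : A → A → Prop) : Prop := ∀ a b, ∃ w, IsOPairOf E w a b

theorem SatDB0.hasPairs {A : Type} {E : A → A → Prop} (h : SatDB0 E) : HasPairs E := by
  intro a b
  obtain ⟨-, -, hp, -⟩ := h
  obtain ⟨s, hs⟩ := hp a a
  obtain ⟨t, ht⟩ := hp a b
  obtain ⟨w, hw⟩ := hp s t
  exact ⟨w, s, t, hs, ht, hw⟩

theorem Sg.exists_or_and {k : ℕ} {P Q : Pred} (hP : Sg k P) (hQ : Sg k Q) :
    (∃ R, Sg k R ∧ ∀ (A : Type) (E : A → A → Prop), HasPairs E → ∀ u,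
      (R A E u ↔ P A E u ∨ Q A E u)) ∧
    (∃ R, Sg k R ∧ ∀ (A : Type) (E : A → A → Prop), HasPairs E → ∀ u,
      (R A E u ↔ P A E u ∧ Q A E u)) := by
  induction k generalizing P Q with
  | zero =>
    exact ⟨⟨_, D0.or hP hQ, fun _ _ _ _ => Iff.rfl⟩, ⟨_, D0.and hP hQ, fun _ _ _ _ => Iff.rfl⟩⟩
  | succ k ih =>
    obtain ⟨P', hP', hPP⟩ := hP
    obtain ⟨Q', hQ', hQQ⟩ := hQ
    constructor
    · obtain ⟨R, hR, hR'⟩ := (ih hP' hQ').2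
      refine ⟨_, ⟨R, hR, fun A E u => Iff.rfl⟩, fun A E hE u => ?_⟩
      simp only [hR' A E hE, hPP, hQQ, not_and_or, exists_or]
    · obtain ⟨R, hR, hR'⟩ := (ih (hP'.subst (1 ∷ fun i => i + 3))
        (hQ'.subst (0 ∷ fun i => i + 3))).1
      refine ⟨_, ⟨_, hR.decAll 0, fun A E u => Iff.rfl⟩, fun A E hE u => ?_⟩
      have e₁ : ∀ b a w : A, (b ∷ a ∷ w ∷ u) ∘ (1 ∷ fun i => i + 3) = a ∷ u := by
        intro b a w
        funext i
        cases i <;> rfl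
      have e₂ : ∀ b a w : A, (b ∷ a ∷ w ∷ u) ∘ (0 ∷ fun i => i + 3) = b ∷ u := by
        intro b a w
        funext i
        cases i <;> rfl
      simp only [not_decAll]
      simp only [DecEx, hR' A E hE, e₁, e₂, hPP, hQQ, not_or]
      constructor
      · rintro ⟨w, a, b, -, ha, hb⟩
        exact ⟨⟨a, ha⟩, ⟨b, hb⟩⟩
      · rintro ⟨⟨a, ha⟩, ⟨b, hb⟩⟩
        obtain ⟨w, hw⟩ := hE a b
        exact ⟨w, a, b, hw, ha, hb⟩

theorem Pg.exists_or {k : ℕ} {P Q : Pred} (hP : Pg k P) (hQ : Pg k Q) :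
    ∃ R, Pg k R ∧ ∀ (A : Type) (E : A → A → Prop), HasPairs E → ∀ u,
      (R A E u ↔ P A E u ∨ Q A E u) := by
  obtain ⟨R, hR, h⟩ := (Sg.exists_or_and hP hQ).2
  refine ⟨_, hR.not, fun A E hE u => ?_⟩
  rw [h A E hE]
  tauto

/-! ### Predicates and formulas -/

/-- `P` is defined by formulas in `Γ`, under every naming of its variables. -/
def DefBy (Γ : Fml → Prop) (P : Pred) : Prop :=
  ∃ K : ℕ, (∀ (A : Type) (E : A → A → Prop) (u u' : ℕ → A),
      (∀ j < K, u j = u' j) → (P A E u ↔ P A E u')) ∧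
    ∀ τ : ℕ → ℕ, ∃ φ, Γ φ ∧ φ.fv ⊆ τ '' {j | j < K} ∧
      ∀ (A : Type) (E : A → A → Prop) (v : ℕ → A), Sat E v φ ↔ P A E (v ∘ τ)

theorem exists_fresh (τ : ℕ → ℕ) (K : ℕ) : ∃ x, ∀ j < K, τ j ≠ x := by
  obtain ⟨x, hx⟩ := ((Set.finite_lt_nat K).image τ).exists_notMem
  exact ⟨x, fun j hj h => hx ⟨j, hj, h⟩⟩

theorem update_comp_scons_agree {A : Type} {τ : ℕ → ℕ} {x K : ℕ} (hx : ∀ j < K, τ j ≠ x)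
    (v : ℕ → A) (a : A) :
    ∀ j < K, (Function.update v x a ∘ (x ∷ τ)) j = (a ∷ (v ∘ τ)) j := by
  intro j hj
  cases j with
  | zero => simp [scons]
  | succ j => exact Function.update_of_ne (hx j (by omega)) _ _

theorem fv_diff_subset {φ : Fml} {τ : ℕ → ℕ} {x K L : ℕ} (hKL : K ≤ L)
    (h : φ.fv ⊆ (x ∷ τ) '' {j | j < K}) : φ.fv \ {x} ⊆ τ '' {j | j < L} := by
  rintro y ⟨hy, hyx⟩
  obtain ⟨j, hj, rfl⟩ := h hy
  cases j with
  | zero => exact absurd rfl hyx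
  | succ j =>
    refine ⟨j, ?_, rfl⟩
    simp only [Set.mem_ofPred_eq] at hj ⊢
    omega

theorem D0.defBy {P : Pred} (h : D0 P) : DefBy IsDelta0 P := by
  induction h with
  | mem i j =>
    refine ⟨max i j + 1, fun A E u u' h => ?_, fun τ => ⟨_, IsDelta0.mem (τ i) (τ j), ?_, ?_⟩⟩
    · beta_reduce
      rw [h i (by omega), h j (by omega)]
    · rintro _ (rfl | rfl)
      · exact ⟨i, by simp only [Set.mem_ofPred_eq]; omega, rfl⟩
      · exact ⟨j, by simp only [Set.mem_ofPred_eq]; omega, rfl⟩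
    · exact fun A E v => Iff.rfl
  | eq i j =>
    refine ⟨max i j + 1, fun A E u u' h => ?_, fun τ => ⟨_, IsDelta0.eq (τ i) (τ j), ?_, ?_⟩⟩
    · beta_reduce
      rw [h i (by omega), h j (by omega)]
    · rintro _ (rfl | rfl)
      · exact ⟨i, by simp only [Set.mem_ofPred_eq]; omega, rfl⟩
      · exact ⟨j, by simp only [Set.mem_ofPred_eq]; omega, rfl⟩
    · exact fun A E v => Iff.rfl
  | not _ ih =>
    obtain ⟨K, hK, ih⟩ := ih
    refine ⟨K, fun A E u u' h => not_congr (hK A E u u' h), fun τ => ?_⟩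
    obtain ⟨φ, hφ, hfv, hsat⟩ := ih τ
    exact ⟨_, hφ.not, hfv, fun A E v => not_congr (hsat A E v)⟩
  | and _ _ ih₁ ih₂ =>
    obtain ⟨K, hK, ih₁⟩ := ih₁
    obtain ⟨L, hL, ih₂⟩ := ih₂
    refine ⟨max K L, fun A E u u' h => and_congr (hK A E u u' fun j hj => h j (by omega))
      (hL A E u u' fun j hj => h j (by omega)), fun τ => ?_⟩
    obtain ⟨φ, hφ, hfv, hsat⟩ := ih₁ τ
    obtain ⟨ψ, hψ, hfv', hsat'⟩ := ih₂ τ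
    refine ⟨_, hφ.and hψ, Set.union_subset (hfv.trans (Set.image_mono ?_))
      (hfv'.trans (Set.image_mono ?_)), fun A E v => and_congr (hsat A E v) (hsat' A E v)⟩
    · exact fun j (hj : j < K) => lt_max_of_lt_left hj
    · exact fun j (hj : j < L) => lt_max_of_lt_right hj
  | @bex P j _ ih =>
    obtain ⟨K, hK, ih⟩ := ih
    refine ⟨max K (j + 1), fun A E u u' h => ?_, fun τ => ?_⟩
    · refine exists_congr fun a => and_congr (by rw [h j (by omega)]) (hK A E _ _ fun i hi => ?_)
      cases i with
      | zero => rfl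
      | succ i => exact h i (by omega)
    · obtain ⟨x, hx⟩ := exists_fresh τ (max K (j + 1))
      have hxj : τ j ≠ x := hx j (by omega)
      obtain ⟨φ, hφ, hfv, hsat⟩ := ih (x ∷ τ)
      refine ⟨_, hφ.bex (i := x) (j := τ j) hxj.symm, ?_, fun A E v => ?_⟩
      · rintro y ⟨(rfl | rfl) | hy, hyx⟩
        · exact absurd rfl hyx
        · exact ⟨j, by simp only [Set.mem_ofPred_eq]; omega, rfl⟩
        · exact fv_diff_subset (le_max_left _ _) hfv ⟨hy, hyx⟩
      · have h₁ : Sat E v (.ex x ((Fml.mem x (τ j)).and φ)) ↔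
            ∃ a, E a (v (τ j)) ∧ Sat E (Function.update v x a) φ := by
          simp [Sat, SatIn, Function.update_of_ne hxj]
        rw [h₁]
        refine exists_congr fun a => and_congr Iff.rfl ((hsat A E _).trans (hK A E _ _ ?_))
        exact update_comp_scons_agree (fun i hi => hx i (by omega)) v a

theorem Sg.defBy {k : ℕ} {P : Pred} (h : Sg k P) :
    DefBy (IsSigma k) P ∧ DefBy (IsPi k) (fun A E u => ¬ P A E u) := by
  induction k generalizing P with
  | zero => exact ⟨D0.defBy h, (D0.not h).defBy⟩
  | succ k ih =>
    obtain ⟨Q, hQ, hPQ⟩ := h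
    obtain ⟨⟨K, hK, ih₁⟩, ⟨L, hL, ih₂⟩⟩ := ih hQ
    have hloc : ∀ (B : ℕ) (_ : ∀ (A : Type) (E : A → A → Prop) (u u' : ℕ → A),
        (∀ j < B, u j = u' j) → (¬ Q A E u ↔ ¬ Q A E u')) (A : Type) (E : A → A → Prop)
        (u u' : ℕ → A), (∀ j < B, u j = u' j) → (P A E u ↔ P A E u') := by
      intro B hB A E u u' h
      rw [hPQ, hPQ]
      refine exists_congr fun a => hB A E _ _ fun i hi => ?_
      cases i with
      | zero => rfl
      | succ i => exact h i (by omega)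
    constructor
    · refine ⟨L, hloc L hL, fun τ => ?_⟩
      obtain ⟨x, hx⟩ := exists_fresh τ L
      obtain ⟨φ, hφ, hfv, hsat⟩ := ih₂ (x ∷ τ)
      refine ⟨.ex x φ, ⟨x, φ, hφ, rfl⟩, fv_diff_subset le_rfl hfv, fun A E v => ?_⟩
      have h₁ : Sat E v (.ex x φ) ↔ ∃ a, Sat E (Function.update v x a) φ := by
        simp [Sat, SatIn]
      rw [h₁, hPQ]
      exact exists_congr fun a => (hsat A E _).trans
        (hL A E _ _ (update_comp_scons_agree hx v a))
    · refine ⟨K, fun A E u u' h => not_congr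
        (hloc K (fun A E u u' h => not_congr (hK A E u u' h)) A E u u' h), fun τ => ?_⟩
      obtain ⟨x, hx⟩ := exists_fresh τ K
      obtain ⟨φ, hφ, hfv, hsat⟩ := ih₁ (x ∷ τ)
      refine ⟨.all x φ, ⟨x, φ, hφ, rfl⟩, fv_diff_subset le_rfl hfv, fun A E v => ?_⟩
      have h₁ : Sat E v (.all x φ) ↔ ∀ a, Sat E (Function.update v x a) φ := by
        simp [Sat, SatIn]
      beta_reduce
      rw [h₁, hPQ]
      push Not
      exact forall_congr' fun a => (hsat A E _).trans
        (hK A E _ _ (update_comp_scons_agree hx v a))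

theorem update_comp {A : Type} (u : ℕ → A) (ρ : ℕ → ℕ) (i : ℕ) (a : A) :
    Function.update (u ∘ ρ) i a = (a ∷ u) ∘ Function.update (Nat.succ ∘ ρ) i 0 := by
  funext j
  by_cases h : j = i
  · subst h
    simp [scons]
  · simp [h, scons]

theorem IsDelta0.d0 {φ : Fml} (h : IsDelta0 φ) :
    ∀ ρ : ℕ → ℕ, D0 (fun _ E u => Sat E (u ∘ ρ) φ) := by
  induction h with
  | mem i j => exact fun ρ => D0.mem (ρ i) (ρ j)
  | eq i j => exact fun ρ => D0.eq (ρ i) (ρ j)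
  | not _ ih => exact fun ρ => (ih ρ).not
  | and _ _ ih₁ ih₂ => exact fun ρ => (ih₁ ρ).and (ih₂ ρ)
  | or _ _ ih₁ ih₂ => exact fun ρ => (ih₁ ρ).or (ih₂ ρ)
  | imp _ _ ih₁ ih₂ => exact fun ρ => (ih₁ ρ).imp (ih₂ ρ)
  | @ball i j φ hij _ ih =>
    intro ρ
    refine ((ih (Function.update (Nat.succ ∘ ρ) i 0)).ball (ρ j)).congr fun A E u => ?_
    simp [Sat, SatIn, ← update_comp, Function.update_of_ne hij.symm]
  | @bex i j φ hij _ ih =>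
    intro ρ
    refine ((ih (Function.update (Nat.succ ∘ ρ) i 0)).bex (ρ j)).congr fun A E u => ?_
    simp [Sat, SatIn, ← update_comp, Function.update_of_ne hij.symm]

theorem levels_sg (k : ℕ) :
    (∀ φ, IsSigma k φ → ∀ ρ : ℕ → ℕ, Sg k (fun _ E u => Sat E (u ∘ ρ) φ)) ∧
    (∀ φ, IsPi k φ → ∀ ρ : ℕ → ℕ, Pg k (fun _ E u => Sat E (u ∘ ρ) φ)) := by
  induction k with
  | zero => exact ⟨fun φ h ρ => IsDelta0.d0 h ρ, fun φ h ρ => (IsDelta0.d0 h ρ).not⟩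
  | succ k ih =>
    constructor
    · rintro _ ⟨i, ψ, hψ, rfl⟩ ρ
      refine (Pg.ex (ih.2 ψ hψ (Function.update (Nat.succ ∘ ρ) i 0))).congr fun A E u => ?_
      simp [Sat, SatIn, ← update_comp]
    · rintro _ ⟨i, ψ, hψ, rfl⟩ ρ
      refine (Sg.all (ih.1 ψ hψ (Function.update (Nat.succ ∘ ρ) i 0))).congr fun A E u => ?_
      simp [Sat, SatIn, ← update_comp]

/-! ### Collection and separation with arbitrary parameters -/

theorem Pg.exists_truncated_code {k : ℕ} (m : ℕ) {P : Pred} (hP : Pg k P) :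
    ∃ P', Pg k P' ∧ ∀ (A : Type) (E : A → A → Prop), HasPairs E → ∀ u : ℕ → A, ∃ w, ∀ y x,
      (P A E (y ∷ x ∷ fun j => u (min j m)) ↔ P' A E (y ∷ x ∷ fun _ => w)) := by
  induction m generalizing P with
  | zero => exact ⟨P, hP, fun A E _ u => ⟨u 0, fun y x => by simp⟩⟩
  | succ m ih =>
    obtain ⟨P', hP', h⟩ := ih ((hP.subst
      (2 ∷ 3 ∷ fun j => if j < m then j + 4 else if j = m then 1 else 0)).decEx (m + 2))
    refine ⟨P', hP', fun A E hE u => ?_⟩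
    obtain ⟨c, hc⟩ := hE (u m) (u (m + 1))
    obtain ⟨w, hw⟩ := h A E hE (Function.update u m c)
    refine ⟨w, fun y x => ?_⟩
    rw [← hw y x]
    have key : (u (m + 1) ∷ u m ∷ y ∷ x ∷ fun j => Function.update u m c (min j m)) ∘
        (2 ∷ 3 ∷ fun j => if j < m then j + 4 else if j = m then 1 else 0) =
        y ∷ x ∷ fun j => u (min j (m + 1)) := by
      funext j
      rcases j with _ | _ | j
      · rfl
      · rfl
      · simp only [Function.comp, scons]
        split_ifs with h₁ h₂
        · have e₁ : min j m = j := by omega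
          have e₂ : min j (m + 1) = j := by omega
          simp [e₁, e₂, h₁.ne]
        · simp [h₂]
        · have e : min j (m + 1) = m + 1 := by omega
          simp [e]
    have hcm : (y ∷ x ∷ fun j => Function.update u m c (min j m)) (m + 2) = c := by
      simp [scons]
    unfold DecEx
    rw [hcm]
    constructor
    · intro hp
      refine ⟨_, _, hc, ?_⟩
      beta_reduce
      rw [key]
      exact hp
    · rintro ⟨a, b, hab, hp⟩
      obtain ⟨rfl, rfl⟩ := hc.inj hab
      rwa [key] at hp

theorem Pg.exists_code {k : ℕ} {P : Pred} (hP : Pg k P) :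
    ∃ P', Pg k P' ∧ ∀ (A : Type) (E : A → A → Prop), HasPairs E → ∀ u : ℕ → A, ∃ w, ∀ y x,
      (P A E (y ∷ x ∷ u) ↔ P' A E (y ∷ x ∷ fun _ => w)) := by
  obtain ⟨K, hK, -⟩ := (Sg.defBy hP).1
  obtain ⟨P', hP', h⟩ := hP.exists_truncated_code K
  refine ⟨P', hP', fun A E hE u => ?_⟩
  obtain ⟨w, hw⟩ := h A E hE u
  refine ⟨w, fun y x => ?_⟩
  rw [← hw y x, ← not_iff_not]
  refine hK A E _ _ fun j hj => ?_
  rcases j with _ | _ | j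
  · rfl
  · rfl
  · have e : min j K = j := by omega
    simp [scons, e]

/-- Collection for Π_k predicates, with arbitrary parameters. -/
def CollPg {A : Type} (E : A → A → Prop) (k : ℕ) : Prop :=
  ∀ P, Pg k P → ∀ (u : ℕ → A) (p : A), (∀ x, E x p → ∃ y, P A E (y ∷ x ∷ u)) →
    ∃ q, ∀ x, E x p → ∃ y, E y q ∧ P A E (y ∷ x ∷ u)

/-- Separation for Σ_k predicates, with arbitrary parameters. -/
def SepSg {A : Type} (E : A → A → Prop) (k : ℕ) : Prop :=
  ∀ P, Sg k P → ∀ (u : ℕ → A) (p : A), ∃ q, ∀ x, E x q ↔ E x p ∧ P A E (x ∷ u)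

theorem CollPg.mono {A : Type} {E : A → A → Prop} {k l : ℕ} (hkl : k ≤ l) (h : CollPg E l) :
    CollPg E k :=
  fun P hP => h P (hP.mono hkl)

theorem collPg_of_collScheme {A : Type} {E : A → A → Prop} {k : ℕ} (hE : HasPairs E)
    (h : CollScheme E (IsSigma (k + 1))) : CollPg E k := by
  intro P hP u p hp
  obtain ⟨P', hP', hcode⟩ := hP.exists_code
  obtain ⟨w, hw⟩ := hcode A E hE u
  obtain ⟨K, -, hdef⟩ := (hP'.toSg.defBy).1
  obtain ⟨φ, hφ, hfv, hsat⟩ := hdef (1 ∷ 0 ∷ fun _ => 2)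
  have key : ∀ x y, Sat E (val3 x y w) φ ↔ P A E (y ∷ x ∷ u) := by
    intro x y
    rw [hsat, hw]
    have : val3 x y w ∘ (1 ∷ 0 ∷ fun _ => 2) = y ∷ x ∷ fun _ => w := by
      funext j
      rcases j with _ | _ | j <;> rfl
    rw [this]
  have hfv' : φ.fv ⊆ {0, 1, 2} := by
    refine hfv.trans ?_
    rintro _ ⟨j, -, rfl⟩
    rcases j with _ | _ | j <;> simp [scons]
  have := h φ hφ hfv' w p
  simp only [key] at this
  exact this hp

theorem SatDB0.sepSg_zero {A : Type} {E : A → A → Prop} (h : SatDB0 E) : SepSg E 0 := by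
  intro P hP u p
  have hP' : Pg 0 (fun A E u => P A E (u ∘ Nat.succ)) := (D0.subst hP Nat.succ).not
  obtain ⟨P', hP'', hcode⟩ := hP'.exists_code
  obtain ⟨w, hw⟩ := hcode A E h.hasPairs u
  have hD : D0 P' := (D0.not hP'').congr fun _ _ _ => not_not
  obtain ⟨K, -, hdef⟩ := hD.defBy
  obtain ⟨φ, hφ, hfv, hsat⟩ := hdef (0 ∷ 0 ∷ fun _ => 1)
  have key : ∀ x, Sat E (val2 x w) φ ↔ P A E (x ∷ u) := by
    intro x
    have : val2 x w ∘ (0 ∷ 0 ∷ fun _ => 1) = x ∷ x ∷ fun _ => w := by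
      funext j
      rcases j with _ | _ | j <;> rfl
    rw [hsat, this, ← hw]
    rfl
  have hfv' : φ.fv ⊆ {0, 1} := by
    refine hfv.trans ?_
    rintro _ ⟨j, -, rfl⟩
    rcases j with _ | _ | j <;> simp [scons]
  have := h.2.2.2.2.2 φ hφ hfv' w p
  simpa only [key] using this

theorem SepSg.sepPg {A : Type} {E : A → A → Prop} {k : ℕ} (h₀ : SepSg E 0) (h : SepSg E k)
    {P : Pred} (hP : Pg k P) (u : ℕ → A) (p : A) :
    ∃ q, ∀ x, E x q ↔ E x p ∧ P A E (x ∷ u) := by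
  obtain ⟨s, hs⟩ := h _ hP u p
  obtain ⟨q, hq⟩ := h₀ (fun _ E u => ¬ E (u 0) (u 1)) (D0.mem 0 1).not (s ∷ u) p
  refine ⟨q, fun x => ?_⟩
  rw [hq]
  change E x p ∧ ¬ E x s ↔ _
  rw [hs]
  tauto

theorem SatDB0.exists_graph {A : Type} {E : A → A → Prop} (h : SatDB0 E) {k : ℕ}
    (hS : SepSg E k) {P : Pred} (hP : Pg k P) (u : ℕ → A) (p q : A) :
    ∃ g, ∀ w, E w g ↔ ∃ x y, E x p ∧ E y q ∧ IsOPairOf E w x y ∧ P A E (y ∷ x ∷ u) := by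
  obtain ⟨c, hc⟩ := h.2.2.2.2.1 p q
  obtain ⟨g, hg⟩ := h.sepSg_zero.sepPg hS ((hP.subst (0 ∷ 1 ∷ fun i => i + 3)).decEx 0) u c
  refine ⟨g, fun w => ?_⟩
  have key : ∀ b a : A, (b ∷ a ∷ w ∷ u) ∘ (0 ∷ 1 ∷ fun i => i + 3) = b ∷ a ∷ u := by
    intro b a
    funext i
    rcases i with _ | _ | i <;> rfl
  rw [hg, hc]
  simp only [DecEx, key]
  constructor
  · rintro ⟨⟨x, y, hx, hy, hw⟩, x', y', hw', hp⟩
    obtain ⟨rfl, rfl⟩ := hw.inj hw'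
    exact ⟨x, y, hx, hy, hw, hp⟩
  · rintro ⟨x, y, hx, hy, hw, hp⟩
    exact ⟨⟨x, y, hx, hy, hw⟩, x, y, hw, hp⟩

theorem SatDB0.sepSg_succ {A : Type} {E : A → A → Prop} (h : SatDB0 E) {k : ℕ}
    (hS : SepSg E k) (hC : CollPg E (k + 1)) : SepSg E (k + 1) := by
  rintro P ⟨Q, hQ, hPQ⟩ u p
  have hall : Pg (k + 1) (fun A E u => ∀ z, Q A E (z ∷ (u ∘ Nat.succ))) := by
    refine (Sg.all (hQ.subst (0 ∷ fun i => i + 2))).congr fun A E u => ?_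
    refine forall_congr' fun z => ?_
    have : (z ∷ u) ∘ (0 ∷ fun i => i + 2) = z ∷ (u ∘ Nat.succ) := by
      funext i
      cases i <;> rfl
    rw [this]
  obtain ⟨R, hR, hR'⟩ := Pg.exists_or hQ.not.succ hall
  replace hR' := hR' A E h.hasPairs
  have hex : ∀ x, E x p → ∃ y, R A E (y ∷ x ∷ u) := by
    intro x _
    by_cases hx : ∃ y, ¬ Q A E (y ∷ x ∷ u)
    · exact hx.imp fun y hy => (hR' _).2 (Or.inl hy)
    · push Not at hx
      exact ⟨x, (hR' _).2 (Or.inr hx)⟩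
  obtain ⟨q, hq⟩ := hC R hR u p hex
  obtain ⟨g, hg⟩ := h.exists_graph hS hQ.not u p q
  obtain ⟨s, hs⟩ := h.sepSg_zero
    (fun _ E u => ∃ w, E w (u 1) ∧ ∃ a b, IsOPairOf E w a b ∧ a = u 0)
    (((D0.eq 1 3).decEx 0).bex 1) (g ∷ u) p
  refine ⟨s, fun x => ?_⟩
  rw [hs, hPQ]
  change E x p ∧ (∃ w, E w g ∧ ∃ a b, IsOPairOf E w a b ∧ a = x) ↔ _
  refine and_congr_right fun hx => ⟨?_, ?_⟩
  · rintro ⟨w, hw, a, b, hab, rfl⟩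
    obtain ⟨x', y, -, -, hw', hy⟩ := (hg w).1 hw
    obtain ⟨rfl, rfl⟩ := hab.inj hw'
    exact ⟨b, hy⟩
  · rintro ⟨z, hz⟩
    obtain ⟨y, hyq, hy⟩ := hq x hx
    rcases (hR' _).1 hy with hy | hy
    · obtain ⟨w, hw⟩ := h.hasPairs x y
      exact ⟨w, (hg w).2 ⟨x, y, hx, hyq, hw, hy⟩, x, y, hw, rfl⟩
    · exact absurd (hy z) hz

theorem SatDB0.sepSg {A : Type} {E : A → A → Prop} (h : SatDB0 E) {k : ℕ}
    (hC : CollPg E k) : SepSg E k := by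
  induction k with
  | zero => exact h.sepSg_zero
  | succ k ih => exact h.sepSg_succ (ih (hC.mono k.le_succ)) hC

theorem SatDB0.collScheme {A : Type} {E : A → A → Prop} (h : SatDB0 E) {k : ℕ}
    (hC : CollPg E k) : CollScheme E (IsSigma (k + 1)) := by
  rintro _ ⟨i, ψ, hψ, rfl⟩ - v p hp
  have hsat : ∀ x y, Sat E (val3 x y v) (.ex i ψ) ↔
      ∃ a, Sat E (Function.update (val3 x y v) i a) ψ := by
    intro x y
    simp [Sat, SatIn]
  simp only [hsat] at hp ⊢
  have hP := ((levels_sg k).2 ψ hψ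
    (Function.update (3 ∷ 1 ∷ fun _ => 4) i 0)).decEx 0
  have key : ∀ a y w x, (a ∷ y ∷ w ∷ x ∷ fun _ => v) ∘
      (Function.update (3 ∷ 1 ∷ fun _ => 4) i 0) = Function.update (val3 x y v) i a := by
    intro a y w x
    funext j
    by_cases hj : j = i
    · subst hj
      simp [scons]
    · rcases j with _ | _ | j <;> simp [hj, scons, val3]
  obtain ⟨q, hq⟩ := hC _ hP (fun _ => v) p fun x hx => by
    obtain ⟨y, a, ha⟩ := hp x hx
    obtain ⟨w, hw⟩ := h.hasPairs y a
    refine ⟨w, y, a, hw, ?_⟩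
    beta_reduce
    rw [key]
    exact ha
  obtain ⟨r, hr⟩ := h.2.2.2.1 q
  obtain ⟨s, hs⟩ := h.2.2.2.1 r
  refine ⟨s, fun x hx => ?_⟩
  obtain ⟨w, hwq, y, a, hw, ha⟩ := hq x hx
  rw [key] at ha
  obtain ⟨t, htw, hyt, -⟩ := IsOPairOf.exists_mem hw
  exact ⟨y, (hs y).2 ⟨t, (hr t).2 ⟨w, hwq, htw⟩, hyt⟩, a, ha⟩

/-! ### The extension argument -/

/-- Over structures with pairs, a Π_k predicate has a Π_k variant with an additional dummy
argument whose bounded universal quantification is Π_k over all structures. -/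
theorem Pg.exists_ball {k : ℕ} {P : Pred} (hP : Pg k P) :
    ∃ C D : Pred, Pg k C ∧ Pg k D ∧
      (∀ (A : Type) (E : A → A → Prop), HasPairs E → ∀ w u, (C A E (w ∷ u) ↔ P A E u)) ∧
      ∀ (A : Type) (E : A → A → Prop) (g x : A) (u : ℕ → A), D A E (g ∷ x ∷ u) ↔
        ∀ w, E w g → ∀ y z, IsOPairOf E w y z → C A E (w ∷ z ∷ y ∷ x ∷ u) := by
  cases k with
  | zero =>
    have hP' : D0 P := (D0.not hP).congr fun _ _ _ => not_not
    have hD := (Sg.decAll (k := 0) (hP'.subst (0 ∷ 1 ∷ fun i => i + 4)) 0)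
    refine ⟨_, _, Pg.subst hP Nat.succ, (D0.ball 0 hD).not, fun A E _ w u => Iff.rfl,
      fun A E g x u => ?_⟩
    have key : ∀ z y w : A, (z ∷ y ∷ w ∷ g ∷ x ∷ u) ∘ (0 ∷ 1 ∷ fun i => i + 4) =
        z ∷ y ∷ x ∷ u := by
      intro z y w
      funext i
      rcases i with _ | _ | i <;> rfl
    simp only [DecAll, key]
    rfl
  | succ k =>
    obtain ⟨Q, hQ, hPQ⟩ := hP.exists_all
    have hC := (((D0.eq 1 3).not.and_Sg_and_or_Sg (hQ.subst (0 ∷ fun i => i + 4))).2.decAll 0).all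
    have hD := ((((D0.mem 3 5).not.and_Sg_and_or_Sg
      (hQ.subst (2 ∷ 0 ∷ 1 ∷ fun i => i + 6))).2.decAll 1).decAll 0).all
    refine ⟨_, _, hC, hD, fun A E hE w u => ?_, fun A E g x u => ?_⟩
    · have key : ∀ b a t : A, (b ∷ a ∷ t ∷ w ∷ u) ∘ (0 ∷ fun i => i + 4) = b ∷ u := by
        intro b a t
        funext i
        cases i <;> rfl
      simp only [DecAll, key, hPQ]
      constructor
      · intro h b
        obtain ⟨t, ht⟩ := hE w b
        exact (h t w b ht).resolve_left (not_not_intro rfl)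
      · exact fun h t a b _ => Or.inr (h b)
    · have key₁ : ∀ z y b a t : A, (z ∷ y ∷ b ∷ a ∷ t ∷ g ∷ x ∷ u) ∘
          (2 ∷ 0 ∷ 1 ∷ fun i => i + 6) = b ∷ z ∷ y ∷ x ∷ u := by
        intro z y b a t
        funext i
        rcases i with _ | _ | _ | i <;> rfl
      have key₂ : ∀ b a t w z y : A, (b ∷ a ∷ t ∷ w ∷ z ∷ y ∷ x ∷ u) ∘ (0 ∷ fun i => i + 4) =
          b ∷ z ∷ y ∷ x ∷ u := by
        intro b a t w z y
        funext i
        cases i <;> rfl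
      simp only [DecAll, key₁, key₂]
      constructor
      · intro h w hw y z hyz t a b hab
        by_cases haw : a = w
        · subst haw
          exact Or.inr ((h t a b hab y z hyz).resolve_left (not_not_intro hw))
        · exact Or.inl haw
      · intro h t a b hab y z hyz
        by_cases hag : E a g
        · exact Or.inr ((h a hag y z hyz t a b hab).resolve_left (not_not_intro rfl))
        · exact Or.inl hag

/-- In a model of `DB₀` with a taller end extension to which truth of Π_{k+2} predicates is
preserved, Π_k collection can be strengthened to Π_{k+1} collection. -/
theorem CollPg.succ {M N : Type} {EM : M → M → Prop} {EN : N → N → Prop} {f : M → N} {k : ℕ}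
    (h : CollPg EM k) (hM : SatDB0 EM) (hsub : SubStr EM EN f) (hend : IsEndEmb EN f)
    (htall : Taller EN f)
    (htr : ∀ P, Pg (k + 2) P → ∀ u : ℕ → M, P M EM u → P N EN (f ∘ u)) :
    CollPg EM (k + 1) := by
  intro P hP e p hp
  obtain ⟨R, hR, hPR⟩ := hP.exists_all
  obtain ⟨C, D, hC, hD, hCR, hDC⟩ := hR.not.exists_ball
  replace hCR := hCR M EM hM.hasPairs
  by_contra hq
  push Not at hq
  have hS := (D0.and_Pg ((D0.mem 1 4).and ((((D0.eq 1 3).decEx 0).bex 1).ball 3))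
    (hD.subst (0 ∷ 1 ∷ fun i => i + 5))).decEx 0 |>.ex.all
  have keyS : ∀ {A : Type} (g x w q p : A) (e : ℕ → A), (g ∷ x ∷ w ∷ q ∷ p ∷ e) ∘
      (0 ∷ 1 ∷ fun i => i + 5) = g ∷ x ∷ e := by
    intro A g x w q p e
    funext i
    rcases i with _ | _ | i <;> rfl
  have hF := (((D0.eq 1 3).not.and_Sg_and_or_Sg
    (hC.subst (2 ∷ 0 ∷ 3 ∷ fun i => i + 4))).2.decAll 0).all
  have keyF : ∀ {A : Type} (z y' w y x : A) (e : ℕ → A), (z ∷ y' ∷ w ∷ y ∷ x ∷ e) ∘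
      (2 ∷ 0 ∷ 3 ∷ fun i => i + 4) = w ∷ z ∷ y ∷ x ∷ e := by
    intro A z y' w y x e
    funext i
    rcases i with _ | _ | _ | i <;> rfl
  have hSM := htr _ hS (p ∷ e) (by
    intro q
    obtain ⟨x, hx, hxq⟩ := hq q
    have hz : ∀ y, EM y q → ∃ z, ¬ R M EM (z ∷ y ∷ x ∷ e) := by
      intro y hy
      have := hxq y hy
      rw [hPR] at this
      push Not at this
      exact this
    obtain ⟨r, hr⟩ := h _ hR.not (x ∷ e) q hz
    obtain ⟨g, hg⟩ := hM.exists_graph (hM.sepSg h) hR.not (x ∷ e) q r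
    obtain ⟨w, hw⟩ := hM.hasPairs x g
    refine ⟨w, x, g, hw, ⟨hx, fun y hy => ?_⟩, ?_⟩
    · obtain ⟨z, hzr, hz⟩ := hr y hy
      obtain ⟨t, ht⟩ := hM.hasPairs y z
      exact ⟨t, (hg t).2 ⟨y, z, hy, hzr, ht, hz⟩, y, z, ht, rfl⟩
    · rw [keyS, hDC]
      intro t ht y z hyz
      obtain ⟨y', z', -, -, hyz', hR'⟩ := (hg t).1 ht
      obtain ⟨rfl, rfl⟩ := hyz.inj hyz'
      exact (hCR _ _).2 hR')
  rw [comp_scons f] at hSM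
  obtain ⟨a, ha⟩ := htall
  obtain ⟨w, x', g, -, ⟨hx', hg⟩, hDg⟩ := hSM a
  rw [keyS, hDC] at hDg
  obtain ⟨x, rfl⟩ := hend p x' hx'
  obtain ⟨y, hy⟩ := hp x ((hsub.2 x p).2 hx')
  obtain ⟨t, ht, y', z, hyz, hy'⟩ := hg (f y) (ha y)
  have hFM := htr _ hF.succ (y ∷ x ∷ e) (by
    intro w y' z _
    beta_reduce
    rw [keyF, hCR, not_not]
    exact Or.inr ((hPR _ _ _).1 hy z))
  have := (hFM t y' z hyz).resolve_left (not_not_intro hy')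
  beta_reduce at this
  rw [comp_scons f, comp_scons f, keyF] at this
  change y' = f y at hy'
  subst hy'
  exact this (hDg t ht _ z hyz)

end FOSet

namespace FOSet

/-- If M ⊨ DB₀ + Coll(Σ₁) has a Σ_{n+2}-elementary end extension
that is taller than M, then M ⊨ Coll(Σ_{n+2}). -/
theorem coll_of_taller_end_extension (n : ℕ) (M N : Type)
    (EM : M → M → Prop) (EN : N → N → Prop) (f : M → N)
    (hM : SatDB0 EM) (hc1 : CollScheme EM (IsSigma 1))
    (hsub : SubStr EM EN f) (helem : SigmaElemEmb (n + 2) EM EN f)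
    (hend : IsEndEmb EN f) (htall : Taller EN f) :
    CollScheme EM (IsSigma (n + 2)) := by
  have htr : ∀ P, Pg (n + 2) P → ∀ u : ℕ → M, P M EM u → P N EN (f ∘ u) := by
    intro P hP u hu
    obtain ⟨K, -, hdef⟩ := (Sg.defBy hP).1
    obtain ⟨φ, hφ, -, hsat⟩ := hdef id
    by_contra hN
    exact (hsat M EM u).1 ((helem φ hφ u).2 ((hsat N EN (f ∘ u)).2 hN)) hu
  have key : ∀ m ≤ n + 1, CollPg EM m := by
    intro m
    induction m with
    | zero => exact fun _ => collPg_of_collScheme hM.hasPairs hc1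
    | succ m ih =>
      exact fun hm => (ih (by omega)).succ hM hsub hend htall
        fun P hP => htr P (hP.mono (by omega))
  exact hM.collScheme (key (n + 1) le_rfl)

end FOSet
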